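/- arXiv:1712.01142 — 8 statements merged into one kernel-verified Lean document; each statement's English description precedes it below -/
import Mathlib

section
/- Let F : ℝⁿ → ℝⁿ be continuous, let σ₁, σ₂ > 0, ρ ∈ (0,1), and let (η_k) be a sequence of positive reals with η = ∑_{k=0}^∞ η_k < ∞. Suppose (x_k) is a sequence in ℝⁿ such that for every k ≥ 0, either ‖F(x_{k+1})‖ ≤ ρ‖F(x_k)‖ − σ₂‖x_{k+1} − x_k‖², or ‖F(x_{k+1})‖ ≤ ‖F(x_k)‖ − σ₁‖x_{k+1} − x_k‖² + η_k‖F(x_k)‖. Then for every k ≥ 0, ‖F(x_k)‖ ≤ e^η ‖F(x_0)‖; that is, the whole sequence (x_k) is contained in the level set Ω = {x ∈ ℝⁿ : ‖F(x)‖ ≤ e^η ‖F(x_0)‖}. -/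
/-- **Lemma 1 (Li–Fukushima level-set containment).**
If each step satisfies either the full-step acceptance test or the nonmonotone
line-search condition, then every iterate stays in the level set
`Ω = {x : ‖F x‖ ≤ e^η ‖F x₀‖}`, where `η = ∑ ηₖ`. -/
theorem stmt_0 {n : ℕ} (F : EuclideanSpace ℝ (Fin n) → EuclideanSpace ℝ (Fin n))
    (hF : Continuous F) (σ₁ σ₂ ρ : ℝ) (hσ₁ : 0 < σ₁) (hσ₂ : 0 < σ₂)
    (hρ : ρ ∈ Set.Ioo (0 : ℝ) 1)
    (η : ℕ → ℝ) (hη : ∀ k, 0 < η k) (hsum : Summable η)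
    (x : ℕ → EuclideanSpace ℝ (Fin n))
    (hstep : ∀ k : ℕ,
      ‖F (x (k + 1))‖ ≤ ρ * ‖F (x k)‖ - σ₂ * ‖x (k + 1) - x k‖ ^ 2 ∨
      ‖F (x (k + 1))‖ ≤ ‖F (x k)‖ - σ₁ * ‖x (k + 1) - x k‖ ^ 2 + η k * ‖F (x k)‖) :
    ∀ k : ℕ, ‖F (x k)‖ ≤ Real.exp (∑' k, η k) * ‖F (x 0)‖ := by
  have h1 : ∀ k, ‖F (x (k + 1))‖ ≤ Real.exp (η k) * ‖F (x k)‖ := by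
    intro k
    have hn := norm_nonneg (F (x k))
    have he : (η k + 1) * ‖F (x k)‖ ≤ Real.exp (η k) * ‖F (x k)‖ :=
      mul_le_mul_of_nonneg_right (Real.add_one_le_exp _) hn
    have hk := mul_nonneg (hη k).le hn
    rcases hstep k with h | h
    · have h2 : 0 ≤ σ₂ * ‖x (k + 1) - x k‖ ^ 2 := by positivity
      have h3 : ρ * ‖F (x k)‖ ≤ 1 * ‖F (x k)‖ := mul_le_mul_of_nonneg_right hρ.2.le hn
      linarith
    · have h2 : 0 ≤ σ₁ * ‖x (k + 1) - x k‖ ^ 2 := by positivity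
      linarith
  have h2 : ∀ k, ‖F (x k)‖ ≤ Real.exp (∑ i ∈ Finset.range k, η i) * ‖F (x 0)‖ := by
    intro k
    induction k with
    | zero => simp
    | succ k ih =>
      rw [Finset.sum_range_succ, Real.exp_add]
      have h3 := mul_le_mul_of_nonneg_left ih (Real.exp_pos (η k)).le
      linarith [h1 k]
  intro k
  refine (h2 k).trans (mul_le_mul_of_nonneg_right (Real.exp_le_exp.2 ?_) (norm_nonneg _))
  exact hsum.sum_le_tsum _ (fun i _ => (hη i).le)
end

section
/- Let F : ℝⁿ → ℝⁿ be continuous, let σ₁, σ₂ > 0, ρ ∈ (0,1), and let (η_k) be a sequence of positive reals with η = ∑_{k=0}^∞ η_k < ∞. Suppose the level set Ω = {x ∈ ℝⁿ : ‖F(x)‖ ≤ e^η ‖F(x_0)‖} is bounded, and (x_k) is a sequence in ℝⁿ such that for every k ≥ 0, either ‖F(x_{k+1})‖ ≤ ρ‖F(x_k)‖ − σ₂‖x_{k+1} − x_k‖², or ‖F(x_{k+1})‖ ≤ ‖F(x_k)‖ − σ₁‖x_{k+1} − x_k‖² + η_k‖F(x_k)‖. Then ∑_{k=0}^∞ ‖x_{k+1}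 − x_k‖² < ∞. -/
/-- **Lemma 2 (Li–Fukushima).** If the level set `Ω` is bounded, then the squared
step lengths are summable: `∑ ‖x_{k+1} − x_k‖² < ∞`. -/
theorem stmt_1 {n : ℕ} (F : EuclideanSpace ℝ (Fin n) → EuclideanSpace ℝ (Fin n))
    (hF : Continuous F) (σ₁ σ₂ ρ : ℝ) (hσ₁ : 0 < σ₁) (hσ₂ : 0 < σ₂)
    (hρ : ρ ∈ Set.Ioo (0 : ℝ) 1)
    (η : ℕ → ℝ) (hη : ∀ k, 0 < η k) (hsum : Summable η)
    (x : ℕ → EuclideanSpace ℝ (Fin n))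
    (hΩ : Bornology.IsBounded
      {y : EuclideanSpace ℝ (Fin n) | ‖F y‖ ≤ Real.exp (∑' k, η k) * ‖F (x 0)‖})
    (hstep : ∀ k : ℕ,
      ‖F (x (k + 1))‖ ≤ ρ * ‖F (x k)‖ - σ₂ * ‖x (k + 1) - x k‖ ^ 2 ∨
      ‖F (x (k + 1))‖ ≤ ‖F (x k)‖ - σ₁ * ‖x (k + 1) - x k‖ ^ 2 + η k * ‖F (x k)‖) :
    Summable (fun k : ℕ => ‖x (k + 1) - x k‖ ^ 2) := by
  obtain ⟨hρ0, hρ1⟩ := hρ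
  have hσ : 0 < min σ₁ σ₂ := lt_min hσ₁ hσ₂
  have key : ∀ k, ‖F (x (k + 1))‖ ≤ ‖F (x k)‖ - min σ₁ σ₂ * ‖x (k + 1) - x k‖ ^ 2
      + η k * ‖F (x k)‖ := by
    intro k
    have h1 : min σ₁ σ₂ * ‖x (k + 1) - x k‖ ^ 2 ≤ σ₁ * ‖x (k + 1) - x k‖ ^ 2 :=
      mul_le_mul_of_nonneg_right (min_le_left _ _) (by positivity)
    have h2 : min σ₁ σ₂ * ‖x (k + 1) - x k‖ ^ 2 ≤ σ₂ * ‖x (k + 1) - x k‖ ^ 2 :=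
      mul_le_mul_of_nonneg_right (min_le_right _ _) (by positivity)
    have h3 : 0 ≤ η k * ‖F (x k)‖ := mul_nonneg (hη k).le (norm_nonneg _)
    have h4 : ρ * ‖F (x k)‖ ≤ 1 * ‖F (x k)‖ :=
      mul_le_mul_of_nonneg_right hρ1.le (norm_nonneg _)
    rcases hstep k with h | h <;> linarith
  have hle : ∀ N, ∑ i ∈ Finset.range N, η i ≤ ∑' k, η k := fun N =>
    hsum.sum_le_tsum _ (fun i _ => (hη i).le)
  have hb : ∀ k, ‖F (x k)‖ ≤ Real.exp (∑ i ∈ Finset.range k, η i) * ‖F (x 0)‖ := by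
    intro k
    induction k with
    | zero => simp
    | succ k ih =>
      have h1 : 0 ≤ min σ₁ σ₂ * ‖x (k + 1) - x k‖ ^ 2 := by positivity
      rw [Finset.sum_range_succ, Real.exp_add]
      calc ‖F (x (k + 1))‖ ≤ (η k + 1) * ‖F (x k)‖ := by linarith [key k]
        _ ≤ Real.exp (η k) * (Real.exp (∑ i ∈ Finset.range k, η i) * ‖F (x 0)‖) :=
          mul_le_mul (Real.add_one_le_exp _) ih (norm_nonneg _) (Real.exp_pos _).le
        _ = _ := by ring
  set M := Real.exp (∑' k, η k) * ‖F (x 0)‖ with hM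
  have hM0 : 0 ≤ M := by positivity
  have hbM : ∀ k, ‖F (x k)‖ ≤ M := fun k => (hb k).trans
    (mul_le_mul_of_nonneg_right (Real.exp_le_exp.2 (hle k)) (norm_nonneg _))
  have hs : ∀ N, min σ₁ σ₂ * ∑ i ∈ Finset.range N, ‖x (i + 1) - x i‖ ^ 2
      ≤ ‖F (x 0)‖ - ‖F (x N)‖ + M * ∑ i ∈ Finset.range N, η i := by
    intro N
    induction N with
    | zero => simp
    | succ N ih =>
      rw [Finset.sum_range_succ, Finset.sum_range_succ, mul_add, mul_add]
      have := mul_le_mul_of_nonneg_left (hbM N) (hη N).le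
      linarith [key N]
  refine summable_of_sum_range_le (c := (‖F (x 0)‖ + M * ∑' k, η k) / min σ₁ σ₂)
    (fun _ => by positivity) (fun N => ?_)
  rw [le_div_iff₀ hσ, mul_comm]
  have := mul_le_mul_of_nonneg_left (hle N) hM0
  linarith [hs N, norm_nonneg (F (x N))]
end

section
/- Let (a_k), (b_k) and (ξ_k) be sequences of positive real numbers and let α > 0 be a constant such that a_{k+1}² ≤ (a_k + b_k)² − α ξ_k² for all k ≥ 0. If ∑_{k=0}^∞ b_k² < ∞, then lim_{k→∞} (1/k) ∑_{i=0}^{k−1} ξ_i² = 0 (in particular, some subsequence of (ξ_k) converges to zero). -/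
open Filter

theorem aux_bound (a b ξ : ℕ → ℝ) (α : ℝ) (hα : 0 < α)
    (ha : ∀ k, 0 < a k) (hb : ∀ k, 0 < b k)
    (hrec : ∀ k : ℕ, (a (k + 1)) ^ 2 ≤ (a k + b k) ^ 2 - α * (ξ k) ^ 2) (k : ℕ) :
    α * ∑ i ∈ Finset.range k, (ξ i) ^ 2 + a k ^ 2 ≤ (a 0 + ∑ i ∈ Finset.range k, b i) ^ 2 := by
  induction k with
  | zero => simp
  | succ k ih =>
    rw [Finset.sum_range_succ, Finset.sum_range_succ]
    have h1 : 0 ≤ ∑ i ∈ Finset.range k, (ξ i) ^ 2 := Finset.sum_nonneg fun i _ => sq_nonneg _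
    have h2 : 0 ≤ ∑ i ∈ Finset.range k, b i := Finset.sum_nonneg fun i _ => (hb i).le
    set S := ∑ i ∈ Finset.range k, b i
    set T := ∑ i ∈ Finset.range k, (ξ i) ^ 2
    have h3 : a k ≤ a 0 + S := by
      apply le_of_sq_le_sq _ (by linarith [ha 0])
      nlinarith [mul_nonneg hα.le h1]
    nlinarith [hrec k, mul_le_mul_of_nonneg_right h3 (hb k).le]

theorem aux_tail (c : ℝ) (b : ℕ → ℝ) (hbsum : Summable (fun k => (b k) ^ 2)) (ε : ℝ) (hε : 0 < ε) :
    ∃ C : ℝ, ∀ᶠ k : ℕ in atTop, (c + ∑ i ∈ Finset.range k, b i) ^ 2 ≤ C + ε * k := by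
  have ht := hbsum.hasSum.tendsto_sum_nat
  obtain ⟨N, hN⟩ := (ht.eventually (lt_mem_nhds
    (show (∑' k, b k ^ 2) - ε / 2 < ∑' k, b k ^ 2 by linarith))).exists
  refine ⟨2 * (c + ∑ i ∈ Finset.range N, b i) ^ 2, ?_⟩
  filter_upwards [eventually_ge_atTop N] with k hk
  have h1 := Finset.sum_range_add_sum_Ico b hk
  have h2 := Finset.sum_range_add_sum_Ico (fun i => b i ^ 2) hk
  have h3 := hbsum.sum_le_tsum (Finset.range k) (fun i _ => sq_nonneg _)
  have h4 := sq_sum_le_card_mul_sum_sq (s := Finset.Ico N k) (f := b)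
  rw [Nat.card_Ico, Nat.cast_sub hk] at h4
  rw [← h1]
  have h0 : 0 ≤ ∑ i ∈ Finset.Ico N k, b i ^ 2 := Finset.sum_nonneg fun i _ => sq_nonneg _
  set P := ∑ i ∈ Finset.range N, b i
  set Q := ∑ i ∈ Finset.Ico N k, b i
  set R := ∑ i ∈ Finset.Ico N k, b i ^ 2
  have h5 : R ≤ ε / 2 := by linarith
  have h6 : Q ^ 2 ≤ k * (ε / 2) := by
    have : (k : ℝ) * R ≤ k * (ε / 2) := by gcongr
    nlinarith [mul_nonneg (Nat.cast_nonneg (α := ℝ) N) h0]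
  nlinarith [sq_nonneg (c + P - Q)]

/-- **Lemma 3, implication (12) (Li–Fukushima).** If `a_{k+1}² ≤ (a_k + b_k)² − α ξ_k²`
for positive sequences and `∑ b_k² < ∞`, then the Cesàro means of `ξ_k²` tend to zero;
in particular some subsequence of `ξ_k` converges to zero. -/
theorem stmt_2 (a b ξ : ℕ → ℝ) (α : ℝ) (hα : 0 < α)
    (ha : ∀ k, 0 < a k) (hb : ∀ k, 0 < b k) (hξ : ∀ k, 0 < ξ k)
    (hrec : ∀ k : ℕ, (a (k + 1)) ^ 2 ≤ (a k + b k) ^ 2 - α * (ξ k) ^ 2)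
    (hbsum : Summable (fun k => (b k) ^ 2)) :
    Tendsto (fun k : ℕ => (1 / (k : ℝ)) * ∑ i ∈ Finset.range k, (ξ i) ^ 2)
        atTop (nhds 0) ∧
      ∃ φ : ℕ → ℕ, StrictMono φ ∧ Tendsto (fun k => ξ (φ k)) atTop (nhds 0) := by
  have key : ∀ ε : ℝ, 0 < ε → ∀ᶠ k : ℕ in atTop, 0 < k ∧
      ∑ i ∈ Finset.range k, (ξ i) ^ 2 < ε * k := by
    intro ε hε
    obtain ⟨C, hC⟩ := aux_tail (a 0) b hbsum (α * ε / 2) (by positivity)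
    have hl : ∀ᶠ k : ℕ in atTop, 2 * C / (α * ε) < k :=
      tendsto_natCast_atTop_atTop.eventually_gt_atTop _
    filter_upwards [hC, hl, eventually_gt_atTop 0] with k h1 h2 h3
    refine ⟨h3, ?_⟩
    have h4 := aux_bound a b ξ α hα ha hb hrec k
    rw [div_lt_iff₀ (by positivity)] at h2
    have : α * ∑ i ∈ Finset.range k, (ξ i) ^ 2 < α * (ε * k) := by
      nlinarith [sq_nonneg (a k)]
    exact lt_of_mul_lt_mul_left this hα.le
  constructor
  · rw [Metric.tendsto_nhds]
    intro ε hε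
    filter_upwards [key ε hε] with k hk
    have hk0 : (0 : ℝ) < k := by exact_mod_cast hk.1
    have h1 : 0 ≤ ∑ i ∈ Finset.range k, (ξ i) ^ 2 := Finset.sum_nonneg fun i _ => sq_nonneg _
    rw [Real.dist_eq, sub_zero, abs_of_nonneg (by positivity), one_div_mul_eq_div,
      div_lt_iff₀ hk0]
    exact hk.2
  · have hf : ∀ n : ℕ, ∃ᶠ k in atTop, ξ k < 1 / ((n : ℝ) + 1) := by
      intro n hn
      have hδ : (0 : ℝ) < 1 / ((n : ℝ) + 1) := by positivity
      set δ := 1 / ((n : ℝ) + 1)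
      obtain ⟨N, hN⟩ := eventually_atTop.1 hn
      obtain ⟨k, hk, hk2⟩ := ((key (δ ^ 2 / 2) (by positivity)).and
        (eventually_ge_atTop (2 * N))).exists
      have hNk : N ≤ k := by omega
      have h1 := Finset.sum_range_add_sum_Ico (fun i => ξ i ^ 2) hNk
      have h2 : 0 ≤ ∑ i ∈ Finset.range N, (ξ i) ^ 2 := Finset.sum_nonneg fun i _ => sq_nonneg _
      have h3 : ((Finset.Ico N k).card) • δ ^ 2 ≤ ∑ i ∈ Finset.Ico N k, ξ i ^ 2 := by
        apply Finset.card_nsmul_le_sum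
        intro i hi
        have := not_lt.1 (hN i (Finset.mem_Ico.1 hi).1)
        gcongr
      rw [Nat.card_Ico, nsmul_eq_mul, Nat.cast_sub hNk] at h3
      have h4 : (2 : ℝ) * N ≤ k := by exact_mod_cast hk2
      have := hk.2
      nlinarith [mul_le_mul_of_nonneg_right h4 (sq_nonneg δ)]
    obtain ⟨φ, hφ, h⟩ := extraction_forall_of_frequently hf
    exact ⟨φ, hφ, squeeze_zero (fun k => (hξ _).le) (fun k => (h k).le)
      tendsto_one_div_add_atTop_nhds_zero_nat⟩
end

section
/- Let (a_k), (b_k) and (ξ_k) be sequences of positive real numbers and let α > 0 be a constant such that a_{k+1}² ≤ (a_k + b_k)² − α ξ_k² for all k ≥ 0. If ∑_{k=0}^∞ b_k < ∞, then ∑_{k=0}^∞ ξ_k² < ∞ (in particular, ξ_k → 0). -/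
open Filter

/-- **Lemma 3, implication (13) (Li–Fukushima).** If `a_{k+1}² ≤ (a_k + b_k)² − α ξ_k²`
for positive sequences and `∑ b_k < ∞`, then `∑ ξ_k² < ∞`; in particular `ξ_k → 0`. -/
theorem stmt_3 (a b ξ : ℕ → ℝ) (α : ℝ) (hα : 0 < α)
    (ha : ∀ k, 0 < a k) (hb : ∀ k, 0 < b k) (hξ : ∀ k, 0 < ξ k)
    (hrec : ∀ k : ℕ, (a (k + 1)) ^ 2 ≤ (a k + b k) ^ 2 - α * (ξ k) ^ 2)
    (hbsum : Summable b) :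
    Summable (fun k => (ξ k) ^ 2) ∧ Tendsto ξ atTop (nhds 0) := by
  have hB : ∀ n, ∑ k ∈ Finset.range n, b k ≤ ∑' k, b k := fun n =>
    hbsum.sum_le_tsum _ (fun k _ => (hb k).le)
  have hbS : ∀ n, b n ≤ ∑' k, b k := fun n =>
    hbsum.le_tsum n (fun k _ => (hb k).le)
  generalize (∑' k, b k) = S at hB hbS
  have hstep : ∀ k, a (k + 1) ≤ a k + b k := by
    intro k
    have h1 : 0 ≤ α * ξ k ^ 2 := by positivity
    have h2 : 0 ≤ a k + b k := (add_pos (ha k) (hb k)).le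
    exact le_of_abs_le (abs_le_of_sq_le_sq (by linarith [hrec k]) h2)
  have hA : ∀ n, a n ≤ a 0 + ∑ k ∈ Finset.range n, b k := by
    intro n
    induction n with
    | zero => simp
    | succ n ih =>
      rw [Finset.sum_range_succ]
      linarith [hstep n]
  have hM : ∀ n, a n ≤ a 0 + S := fun n => by linarith [hA n, hB n]
  have hkey : ∀ n, α * ∑ k ∈ Finset.range n, ξ k ^ 2 + a n ^ 2
      ≤ a 0 ^ 2 + 3 * (a 0 + S) * ∑ k ∈ Finset.range n, b k := by
    intro n
    induction n with
    | zero => simp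
    | succ n ih =>
      rw [Finset.sum_range_succ, Finset.sum_range_succ, mul_add, mul_add]
      have h3 : b n * (2 * a n + b n) ≤ b n * (3 * (a 0 + S)) :=
        mul_le_mul_of_nonneg_left (by linarith [hM n, hbS n, ha 0]) (hb n).le
      nlinarith [hrec n]
  have hS : 0 < a 0 + S := lt_of_lt_of_le (ha 0) (hM 0)
  have hsum : Summable (fun k => (ξ k) ^ 2) := by
    refine summable_of_sum_range_le (c := (a 0 ^ 2 + 3 * (a 0 + S) * S) / α)
      (fun k => sq_nonneg _) (fun n => ?_)
    rw [le_div_iff₀ hα]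
    have h4 : 3 * (a 0 + S) * ∑ k ∈ Finset.range n, b k ≤ 3 * (a 0 + S) * S :=
      mul_le_mul_of_nonneg_left (hB n) (by positivity)
    linarith [hkey n, sq_nonneg (a n)]
  refine ⟨hsum, ?_⟩
  have h5 := (hsum.tendsto_atTop_zero).sqrt
  rw [Real.sqrt_zero] at h5
  exact h5.congr (fun k => Real.sqrt_sq (hξ k).le)
end

section
/- Let B and A be n×n real matrices, let s, c ∈ ℝⁿ with c ≠ 0 satisfy (B − A)c = (B − A)s, let θ ∈ ℝ, and define B⁺ = B + θ (A s − B s) cᵀ / ‖c‖². Then ‖B⁺ − A‖_F² = ‖B − A‖_F² − θ(2 − θ) ‖(B − A)s‖² / ‖c‖². -/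
open Matrix

/-- The Frobenius norm of a square real matrix. -/
noncomputable def frobNorm {n : ℕ} (A : Matrix (Fin n) (Fin n) ℝ) : ℝ :=
  Real.sqrt (∑ i, ∑ j, (A i j) ^ 2)

/-- **Identity (35).** For the update `B⁺ = B + θ (A s − B s) cᵀ/‖c‖²` with
`(B − A)c = (B − A)s`, one has
`‖B⁺ − A‖_F² = ‖B − A‖_F² − θ(2 − θ)‖(B − A)s‖²/‖c‖²`. -/
theorem stmt_8 {n : ℕ} (B A : Matrix (Fin n) (Fin n) ℝ)
    (s c : EuclideanSpace ℝ (Fin n)) (hc : c ≠ 0) (θ : ℝ)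
    (hBAs : (B - A).mulVec c = (B - A).mulVec s) :
    frobNorm (B + (θ / ‖c‖ ^ 2) • Matrix.vecMulVec (A.mulVec s - B.mulVec s) c - A) ^ 2 =
      frobNorm (B - A) ^ 2 -
        θ * (2 - θ) * ‖Matrix.toEuclideanLin (B - A) s‖ ^ 2 / ‖c‖ ^ 2 := by
  have hN : ‖c‖ ^ 2 ≠ 0 := pow_ne_zero 2 (norm_ne_zero_iff.mpr hc)
  have hcN : ‖c‖ ^ 2 = ∑ j, c j ^ 2 := EuclideanSpace.real_norm_sq_eq c
  have hv : ‖Matrix.toEuclideanLin (B - A) s‖ ^ 2 = ∑ i, ((B - A).mulVec s i) ^ 2 := by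
    rw [EuclideanSpace.real_norm_sq_eq]
    rfl
  have hF : ∀ M : Matrix (Fin n) (Fin n) ℝ, frobNorm M ^ 2 = ∑ i, ∑ j, (M i j) ^ 2 := by
    intro M
    unfold frobNorm
    exact Real.sq_sqrt (Finset.sum_nonneg fun i _ => Finset.sum_nonneg fun j _ => sq_nonneg _)
  rw [hF, hF, hv, Finset.mul_sum, Finset.sum_div, ← Finset.sum_sub_distrib]
  refine Finset.sum_congr rfl fun i _ => ?_
  have hi : ∑ j, (B - A) i j * c j = (B - A).mulVec s i := by
    rw [← hBAs]
    rfl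
  have hd : (A.mulVec s - B.mulVec s) i = - (B - A).mulVec s i := by
    rw [Matrix.sub_mulVec]
    simp
  have e : ∀ j, ((B + (θ / ‖c‖ ^ 2) • Matrix.vecMulVec (A.mulVec s - B.mulVec s) c - A) i j) ^ 2
      = (B - A) i j ^ 2 - 2 * (θ / ‖c‖ ^ 2) * (B - A).mulVec s i * ((B - A) i j * c j)
        + ((θ / ‖c‖ ^ 2) * (B - A).mulVec s i) ^ 2 * c j ^ 2 := by
    intro j
    rw [Matrix.sub_apply, Matrix.add_apply, Matrix.smul_apply, Matrix.vecMulVec_apply, hd,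
      Matrix.sub_apply, smul_eq_mul]
    ring
  rw [Finset.sum_congr rfl fun j _ => e j, Finset.sum_add_distrib, Finset.sum_sub_distrib,
    ← Finset.mul_sum, ← Finset.mul_sum, hi, ← hcN]
  field_simp
  ring
end

section
/- Fix n ≥ 1, θ̄ ∈ (0,1) and C > 0. Let (B_k) and (A_k) be sequences of n×n real matrices, (s_k) and (c_k) sequences of nonzero vectors in ℝⁿ, and (θ_k) real numbers with |θ_k − 1| ≤ θ̄, such that for all k ≥ 0: B_{k+1} = B_k + θ_k (A_{k+1} s_k − B_k s_k) c_kᵀ / ‖c_k‖², (B_k − A_{k+1}) c_k = (B_k − A_{k+1}) s_k, and ‖A_{k+1} − A_k‖_F ≤ C ∑_{i=max(0,k−n)}^{k} ‖s_i‖. Define ξ_k = ‖A_{k+1} s_k − B_k s_k‖ / ‖c_k‖. If ∑_{k=0}^∞ ‖s_k‖² < ∞, then lim_{k→∞} (1/k) ∑_{i=0}^{k−1} ξ_i² = 0; in particular, some subsequence of (ξ_k) converges to zero. -/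
open Matrix Filter

theorem aux_S (δ : ℕ → ℝ) (hδ : Summable fun k => δ k ^ 2) :
    Tendsto (fun k : ℕ => (1 / (k : ℝ)) * (∑ i ∈ Finset.range k, δ i) ^ 2) atTop (nhds 0) := by
  rw [Metric.tendsto_atTop]
  intro ε hε
  have h1 := tendsto_sum_nat_add (fun k => δ k ^ 2)
  obtain ⟨N, hN⟩ := ((tendsto_order.1 h1).2 (ε / 4) (by positivity)).exists
  obtain ⟨M, hM⟩ := exists_nat_gt (4 * (∑ i ∈ Finset.range N, δ i) ^ 2 / ε)
  refine ⟨N + M + 1, fun k hk => ?_⟩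
  have hkpos : (0:ℝ) < k := by exact_mod_cast (by omega : 0 < k)
  rw [Real.dist_eq, sub_zero, abs_of_nonneg (by positivity)]
  obtain ⟨m, rfl⟩ : ∃ m, k = N + m := ⟨k - N, by omega⟩
  rw [Finset.sum_range_add]
  have h2 := sq_sum_le_card_mul_sum_sq (s := Finset.range m) (f := fun i => δ (N + i))
  have h3 : ∑ i ∈ Finset.range m, δ (N + i) ^ 2 ≤ ε / 4 := by
    have := ((summable_nat_add_iff N).2 hδ).sum_le_tsum (Finset.range m)
      (fun i _ => sq_nonneg _)
    simp only [add_comm N]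
    linarith
  rw [Finset.card_range] at h2
  have h4 : 4 * (∑ i ∈ Finset.range N, δ i) ^ 2 < ε * (N + m : ℕ) := by
    have : (M:ℝ) ≤ (N + m : ℕ) := by exact_mod_cast (by omega : M ≤ N + m)
    rw [div_lt_iff₀ hε] at hM
    nlinarith
  rw [one_div, inv_mul_lt_iff₀ hkpos]
  have h5 : (m:ℝ) ≤ (N + m : ℕ) := by exact_mod_cast (by omega : m ≤ N + m)
  have h6 : (m:ℝ) * ∑ i ∈ Finset.range m, δ (N + i) ^ 2 ≤ (N + m : ℕ) * (ε / 4) :=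
    mul_le_mul h5 h3 (Finset.sum_nonneg fun i _ => sq_nonneg _) hkpos.le
  nlinarith [sq_nonneg ((∑ i ∈ Finset.range N, δ i) - ∑ i ∈ Finset.range m, δ (N + i))]

theorem aux_cesaro (α : ℝ) (hα : 0 < α) (e δ x : ℕ → ℝ) (he : ∀ k, 0 ≤ e k) (hd : ∀ k, 0 ≤ δ k)
    (hx : ∀ k, 0 ≤ x k) (hδ : Summable fun k => δ k ^ 2)
    (h : ∀ k, α * x k + e (k + 1) ^ 2 ≤ (e k + δ k) ^ 2) :
    Tendsto (fun k : ℕ => (1 / (k : ℝ)) * ∑ i ∈ Finset.range k, x i) atTop (nhds 0) := by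
  have key : ∀ k, α * (∑ i ∈ Finset.range k, x i) + e k ^ 2
      ≤ (e 0 + ∑ i ∈ Finset.range k, δ i) ^ 2 := by
    intro k
    induction k with
    | zero => simp
    | succ k ih =>
      rw [Finset.sum_range_succ, Finset.sum_range_succ]
      have hX : 0 ≤ α * (∑ i ∈ Finset.range k, x i) :=
        mul_nonneg hα.le (Finset.sum_nonneg fun i _ => hx i)
      have hS : 0 ≤ ∑ i ∈ Finset.range k, δ i := Finset.sum_nonneg fun i _ => hd i
      have hle : e k ≤ e 0 + ∑ i ∈ Finset.range k, δ i :=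
        abs_le_of_sq_le_sq' (by linarith) (by linarith [he 0]) |>.2
      have := h k
      nlinarith [mul_le_mul_of_nonneg_right hle (hd k)]
  have hlim : Tendsto (fun k : ℕ => (2 * e 0 ^ 2 / α) * (1 / (k : ℝ)) +
      (2 / α) * ((1 / (k : ℝ)) * (∑ i ∈ Finset.range k, δ i) ^ 2)) atTop (nhds 0) := by
    have := (tendsto_one_div_atTop_nhds_zero_nat (𝕜 := ℝ).const_mul (2 * e 0 ^ 2 / α)).add
      ((aux_S δ hδ).const_mul (2 / α))
    simpa using this
  refine squeeze_zero (fun k => mul_nonneg (by positivity) (Finset.sum_nonneg fun i _ => hx i))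
    (fun k => ?_) hlim
  have h1 : ∑ i ∈ Finset.range k, x i ≤
      2 * e 0 ^ 2 / α + (2 / α) * (∑ i ∈ Finset.range k, δ i) ^ 2 := by
    have : 2 * e 0 ^ 2 / α + (2 / α) * (∑ i ∈ Finset.range k, δ i) ^ 2 =
      (2 * e 0 ^ 2 + 2 * (∑ i ∈ Finset.range k, δ i) ^ 2) / α := by ring
    rw [this, le_div_iff₀ hα]
    nlinarith [key k, sq_nonneg (e 0 - ∑ i ∈ Finset.range k, δ i), sq_nonneg (e k)]
  have h2 : (0:ℝ) ≤ 1 / (k:ℝ) := by positivity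
  nlinarith [mul_le_mul_of_nonneg_left h1 h2]

theorem aux_subseq (ξ : ℕ → ℝ) (hξ : ∀ k, 0 ≤ ξ k)
    (h : Tendsto (fun k : ℕ => (1 / (k : ℝ)) * ∑ i ∈ Finset.range k, (ξ i) ^ 2) atTop (nhds 0)) :
    ∃ φ : ℕ → ℕ, StrictMono φ ∧ Tendsto (fun k => ξ (φ k)) atTop (nhds 0) := by
  have hf : ∀ m : ℕ, ∃ᶠ k in atTop, ξ k < 1 / ((m : ℝ) + 1) := by
    intro m hne
    obtain ⟨N, hN⟩ := eventually_atTop.1 hne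
    set ε : ℝ := (1 / ((m : ℝ) + 1)) ^ 2 with hε
    have hεp : 0 < ε := by positivity
    obtain ⟨K, hK⟩ := eventually_atTop.1 ((tendsto_order.1 h).2 (ε / 2) (by positivity))
    have h1 := hK (N + (N + K + 1)) (by omega)
    have hp : (0:ℝ) < (N + (N + K + 1) : ℕ) := by exact_mod_cast (by omega)
    rw [one_div, inv_mul_lt_iff₀ hp, Finset.sum_range_add] at h1
    have h2 : 0 ≤ ∑ i ∈ Finset.range N, ξ i ^ 2 := Finset.sum_nonneg fun i _ => sq_nonneg _
    have h3 : ∑ i ∈ Finset.range (N + K + 1), ε ≤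
        ∑ i ∈ Finset.range (N + K + 1), ξ (N + i) ^ 2 := by
      refine Finset.sum_le_sum fun i _ => ?_
      exact pow_le_pow_left₀ (by positivity) (not_lt.1 (hN (N + i) (by omega))) 2
    simp only [Finset.sum_const, Finset.card_range, nsmul_eq_mul] at h3
    push_cast at h1 h3
    have : (0:ℝ) ≤ K * ε := by positivity
    nlinarith
  obtain ⟨φ, hφ, hp⟩ := extraction_forall_of_frequently hf
  exact ⟨φ, hφ, squeeze_zero (fun k => hξ _) (fun k => (hp k).le)
    tendsto_one_div_add_atTop_nhds_zero_nat⟩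

theorem frob_sq {n : ℕ} (A : Matrix (Fin n) (Fin n) ℝ) :
    frobNorm A ^ 2 = ∑ i, ∑ j, (A i j) ^ 2 :=
  Real.sq_sqrt (Finset.sum_nonneg fun i _ => Finset.sum_nonneg fun j _ => sq_nonneg _)

theorem frob_eq {n : ℕ} (A : Matrix (Fin n) (Fin n) ℝ) :
    frobNorm A = ‖(WithLp.toLp 2 (fun p : Fin n × Fin n => A p.1 p.2) :
      EuclideanSpace ℝ (Fin n × Fin n))‖ := by
  rw [EuclideanSpace.norm_eq, frobNorm, Fintype.sum_prod_type]
  simp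

theorem frob_sub {n : ℕ} (X Y : Matrix (Fin n) (Fin n) ℝ) :
    frobNorm (X - Y) ≤ frobNorm X + frobNorm Y := by
  rw [frob_eq, frob_eq, frob_eq]
  exact norm_sub_le (WithLp.toLp 2 (fun p : Fin n × Fin n => X p.1 p.2) :
      EuclideanSpace ℝ (Fin n × Fin n)) (WithLp.toLp 2 (fun p : Fin n × Fin n => Y p.1 p.2))

theorem frob_update {n : ℕ} (F : Matrix (Fin n) (Fin n) ℝ) (c : Fin n → ℝ) (N t : ℝ)
    (hN : N = ∑ j, c j ^ 2) (hN0 : N ≠ 0) :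
    frobNorm (F - (t / N) • Matrix.vecMulVec (F.mulVec c) c) ^ 2 =
      frobNorm F ^ 2 - (1 - (t - 1) ^ 2) * ((∑ i, (F.mulVec c i) ^ 2) / N) := by
  rw [frob_sq, frob_sq, Finset.sum_div, Finset.mul_sum, ← Finset.sum_sub_distrib]
  refine Finset.sum_congr rfl fun i _ => ?_
  have hd : ∑ j, F i j * c j = F.mulVec c i := rfl
  have : ∀ j, (F - (t / N) • Matrix.vecMulVec (F.mulVec c) c) i j ^ 2 =
      F i j ^ 2 - 2 * (t / N) * F.mulVec c i * (F i j * c j) +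
        ((t / N) * F.mulVec c i) ^ 2 * c j ^ 2 := by
    intro j
    simp only [Matrix.sub_apply, Matrix.smul_apply, Matrix.vecMulVec_apply, smul_eq_mul]
    ring
  simp only [this]
  rw [Finset.sum_add_distrib, Finset.sum_sub_distrib, ← Finset.mul_sum, ← Finset.mul_sum, hd, ← hN]
  field_simp
  ring

theorem aux_delta {n : ℕ} (C : ℝ) (f : ℕ → ℝ) (hsum : Summable fun k => f k ^ 2) :
    Summable fun k => (C * ∑ j ∈ Finset.range (n + 1), f (k - j)) ^ 2 := by
  have h1 : Summable fun k => C ^ 2 * ((n + 1 : ℕ) *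
      ∑ j ∈ Finset.range (n + 1), f (k - j) ^ 2) := by
    refine Summable.mul_left _ (Summable.mul_left _ (summable_sum fun j _ => ?_))
    rw [← summable_nat_add_iff j]
    simpa using hsum
  refine Summable.of_nonneg_of_le (fun k => sq_nonneg _) (fun k => ?_) h1
  rw [mul_pow]
  refine mul_le_mul_of_nonneg_left ?_ (sq_nonneg C)
  simpa using sq_sum_le_card_mul_sum_sq (s := Finset.range (n + 1)) (f := fun j => f (k - j))

theorem aux_icc {n : ℕ} (f : ℕ → ℝ) (hf : ∀ k, 0 ≤ f k) (k : ℕ) :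
    ∑ i ∈ Finset.Icc (k - n) k, f i ≤ ∑ j ∈ Finset.range (n + 1), f (k - j) := by
  have hinj : Set.InjOn (fun i => k - i) (Finset.Icc (k - n) k : Finset ℕ) := by
    intro a ha b hb hab
    simp at ha hb hab
    omega
  have : ∑ i ∈ Finset.Icc (k - n) k, f i =
      ∑ j ∈ (Finset.Icc (k - n) k).image (fun i => k - i), f (k - j) := by
    rw [Finset.sum_image hinj]
    refine Finset.sum_congr rfl fun i hi => ?_
    rw [Finset.mem_Icc] at hi
    congr 1
    omega
  rw [this]
  refine Finset.sum_le_sum_of_subset_of_nonneg ?_ fun i _ _ => hf _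
  intro j hj
  simp only [Finset.mem_image, Finset.mem_Icc] at hj
  obtain ⟨i, hi, rfl⟩ := hj
  simp
  omega

/-- **Lemma 5, part (30)–(31).** For the quasi-Newton updates
`B_{k+1} = B_k + θ_k (A_{k+1}s_k − B_k s_k)c_kᵀ/‖c_k‖²` with
`(B_k − A_{k+1})c_k = (B_k − A_{k+1})s_k` and slowly varying `A_k`,
if `∑ ‖s_k‖² < ∞` then the Cesàro means of `ξ_k² = (‖A_{k+1}s_k − B_k s_k‖/‖c_k‖)²`
tend to zero; in particular a subsequence of `ξ_k` tends to zero. -/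
theorem stmt_9 {n : ℕ} (hn : 1 ≤ n) (θbar C : ℝ)
    (hθbar : θbar ∈ Set.Ioo (0 : ℝ) 1) (hC : 0 < C)
    (B A : ℕ → Matrix (Fin n) (Fin n) ℝ)
    (s c : ℕ → EuclideanSpace ℝ (Fin n)) (hs : ∀ k, s k ≠ 0) (hc : ∀ k, c k ≠ 0)
    (θ : ℕ → ℝ) (hθ : ∀ k, |θ k - 1| ≤ θbar)
    (hupd : ∀ k : ℕ, B (k + 1) = B k + (θ k / ‖c k‖ ^ 2) •
      Matrix.vecMulVec ((A (k + 1)).mulVec (s k) - (B k).mulVec (s k)) (c k))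
    (hcs : ∀ k : ℕ,
      (B k - A (k + 1)).mulVec (c k) = (B k - A (k + 1)).mulVec (s k))
    (hA : ∀ k : ℕ,
      frobNorm (A (k + 1) - A k) ≤ C * ∑ i ∈ Finset.Icc (k - n) k, ‖s i‖)
    (ξ : ℕ → ℝ)
    (hξ : ∀ k : ℕ, ξ k =
      ‖Matrix.toEuclideanLin (A (k + 1)) (s k) - Matrix.toEuclideanLin (B k) (s k)‖ / ‖c k‖)
    (hsum : Summable fun k => ‖s k‖ ^ 2) :
    Tendsto (fun k : ℕ => (1 / (k : ℝ)) * ∑ i ∈ Finset.range k, (ξ i) ^ 2)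
        atTop (nhds 0) ∧
      ∃ φ : ℕ → ℕ, StrictMono φ ∧ Tendsto (fun k => ξ (φ k)) atTop (nhds 0) := by
  have hξ0 : ∀ k, 0 ≤ ξ k := fun k => by rw [hξ]; positivity
  suffices hmain : Tendsto (fun k : ℕ => (1 / (k : ℝ)) * ∑ i ∈ Finset.range k, (ξ i) ^ 2)
        atTop (nhds 0) from ⟨hmain, aux_subseq ξ hξ0 hmain⟩
  have hα : 0 < 1 - θbar ^ 2 := by nlinarith [hθbar.1, hθbar.2]
  refine aux_cesaro (1 - θbar ^ 2) hα (fun k => frobNorm (B k - A k))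
    (fun k => C * ∑ j ∈ Finset.range (n + 1), ‖s (k - j)‖) (fun k => ξ k ^ 2)
    (fun k => Real.sqrt_nonneg _) (fun k => by positivity) (fun k => sq_nonneg _)
    (aux_delta C (fun k => ‖s k‖) hsum) (fun k => ?_)
  have hN : ‖c k‖ ^ 2 = ∑ j, (c k) j ^ 2 := EuclideanSpace.real_norm_sq_eq _
  have hN0 : ‖c k‖ ^ 2 ≠ 0 := pow_ne_zero 2 (norm_ne_zero_iff.2 (hc k))
  have hE : B (k + 1) - A (k + 1) = (B k - A (k + 1)) - (θ k / ‖c k‖ ^ 2) •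
      Matrix.vecMulVec ((B k - A (k + 1)).mulVec (c k)) (c k) := by
    rw [hcs k, hupd k, Matrix.sub_mulVec, Matrix.sub_vecMulVec, Matrix.sub_vecMulVec,
      smul_sub, smul_sub]
    abel
  have hx : ξ k ^ 2 = (∑ i, ((B k - A (k + 1)).mulVec (c k) i) ^ 2) / ‖c k‖ ^ 2 := by
    rw [hξ, div_pow, EuclideanSpace.real_norm_sq_eq, hcs k, Matrix.sub_mulVec]
    congr 1
    refine Finset.sum_congr rfl fun i _ => ?_
    simp only [Matrix.toLpLin_apply, PiLp.sub_apply, Pi.sub_apply]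
    ring
  have hu := frob_update (B k - A (k + 1)) (c k) _ (θ k) hN hN0
  rw [← hE, ← hx] at hu
  have hθ2 : (θ k - 1) ^ 2 ≤ θbar ^ 2 := by
    rw [← sq_abs]
    exact pow_le_pow_left₀ (abs_nonneg _) (hθ k) 2
  have hF : frobNorm (B k - A (k + 1)) ≤ frobNorm (B k - A k) +
      C * ∑ j ∈ Finset.range (n + 1), ‖s (k - j)‖ := by
    have h1 := frob_sub (B k - A k) (A (k + 1) - A k)
    have h2 := aux_icc (n := n) (fun i => ‖s i‖) (fun i => norm_nonneg _) k
    have h3 := mul_le_mul_of_nonneg_left h2 hC.le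
    rw [sub_sub_sub_cancel_right] at h1
    linarith [hA k]
  have hF0 : 0 ≤ frobNorm (B k - A (k + 1)) := Real.sqrt_nonneg _
  have hF2 := pow_le_pow_left₀ hF0 hF 2
  have := mul_le_mul_of_nonneg_right hθ2 (sq_nonneg (ξ k))
  nlinarith
end

section
/- Fix n ≥ 1, θ̄ ∈ (0,1) and C > 0. Let (B_k) and (A_k) be sequences of n×n real matrices, (s_k) and (c_k) sequences of nonzero vectors in ℝⁿ, and (θ_k) real numbers with |θ_k − 1| ≤ θ̄, such that for all k ≥ 0: B_{k+1} = B_k + θ_k (A_{k+1} s_k − B_k s_k) c_kᵀ / ‖c_k‖², (B_k − A_{k+1}) c_k = (B_k − A_{k+1}) s_k, and ‖A_{k+1} − A_k‖_F ≤ C ∑_{i=max(0,k−n)}^{k} ‖s_i‖. Define ξ_k = ‖A_{k+1} s_k − B_k s_k‖ / ‖c_k‖. If ∑_{k=0}^∞ ‖s_k‖ < ∞, then ∑_{k=0}^∞ ξ_k² < ∞; in particular, the whole sequence (ξ_k) converges to zero. -/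
open Matrix Filter

lemma aux_real (e d x : ℕ → ℝ) (he : ∀ k, 0 ≤ e k) (hd : ∀ k, 0 ≤ d k) (hx : ∀ k, 0 ≤ x k)
    (h : ∀ k, e (k+1) ^ 2 + x k ≤ (e k + d k) ^ 2) (hs : Summable d) : Summable x := by
  have h1 : ∀ k, e (k+1) ≤ e k + d k := fun k => by
    refine (fun h1 h2 => abs_le_of_sq_le_sq' h1 h2 |>.2 : e (k+1) ^ 2 ≤ (e k + d k) ^ 2 → 0 ≤ e k + d k → _) ?_ (add_nonneg (he k) (hd k))
    linarith [h k, hx k]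
  have h2 : ∀ k, e k ≤ e 0 + ∑ i ∈ Finset.range k, d i := by
    intro k
    induction k with
    | zero => simp
    | succ k ih => rw [Finset.sum_range_succ]; linarith [h1 k]
  set M := e 0 + ∑' i, d i with hM
  have h3 : ∀ k, ∑ i ∈ Finset.range k, d i ≤ ∑' i, d i := fun k =>
    hs.sum_le_tsum _ (fun i _ => hd i)
  have h4 : ∀ k, e k + d k ≤ M := fun k => by
    have := h3 (k+1)
    rw [Finset.sum_range_succ] at this
    linarith [h2 k]
  have h5 : ∀ k, x k ≤ e k ^ 2 - e (k+1) ^ 2 + 2 * M * d k := fun k => by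
    nlinarith [h k, mul_le_mul_of_nonneg_left (h4 k) (hd k), hd k, he k, mul_nonneg (hd k) (hd k)]
  have hM0 : 0 ≤ M := by linarith [h4 0, he 0, hd 0]
  have h6 : ∀ k, ∑ i ∈ Finset.range k, x i ≤ e 0 ^ 2 - e k ^ 2 + 2 * M * ∑ i ∈ Finset.range k, d i := by
    intro k
    induction k with
    | zero => simp
    | succ k ih => rw [Finset.sum_range_succ, Finset.sum_range_succ]; linarith [h5 k]
  refine summable_of_sum_range_le (c := e 0 ^ 2 + 2 * M * ∑' i, d i) hx (fun k => ?_)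
  have := mul_le_mul_of_nonneg_left (h3 k) (by linarith : 0 ≤ 2 * M)
  linarith [h6 k, sq_nonneg (e k)]

lemma aux_window (n : ℕ) (f : ℕ → ℝ) (hf : ∀ k, 0 ≤ f k) (hs : Summable f) :
    Summable fun k => ∑ i ∈ Finset.Icc (k - n) k, f i := by
  have h1 : Summable fun k => ∑ j ∈ Finset.range (n+1), f (k - j) := by
    apply summable_sum
    intro j _
    rw [← summable_nat_add_iff j]
    simpa using hs
  refine Summable.of_nonneg_of_le (fun k => Finset.sum_nonneg fun i _ => hf i) (fun k => ?_) h1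
  have h2 : ∑ i ∈ Finset.Icc (k - n) k, f i
      = ∑ j ∈ (Finset.Icc (k - n) k).image (fun i => k - i), f (k - j) := by
    rw [Finset.sum_image]
    · apply Finset.sum_congr rfl
      intro i hi
      rw [Finset.mem_Icc] at hi
      congr 1
      omega
    · intro a ha b hb hab
      simp only [Finset.coe_Icc, Set.mem_Icc] at ha hb hab
      omega
  rw [h2]
  apply Finset.sum_le_sum_of_subset_of_nonneg
  · intro j hj
    simp only [Finset.mem_image, Finset.mem_Icc, Finset.mem_range] at *
    omega
  · intro i _ _
    exact hf _

lemma aux_frob_add {n : ℕ} (X Y : Matrix (Fin n) (Fin n) ℝ) :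
    frobNorm (X + Y) ≤ frobNorm X + frobNorm Y := by
  have key : ∀ Z : Matrix (Fin n) (Fin n) ℝ,
      frobNorm Z = @norm _ Matrix.frobeniusNormedAddCommGroup.toNorm Z := by
    intro Z
    rw [Matrix.frobenius_norm_def, frobNorm, Real.sqrt_eq_rpow]
    simp
  rw [key, key, key]
  exact @norm_add_le _ Matrix.frobeniusNormedAddCommGroup.toSeminormedAddCommGroup.toSeminormedAddGroup X Y

lemma aux_frob_sq {n : ℕ} (X : Matrix (Fin n) (Fin n) ℝ) :
    frobNorm X ^ 2 = ∑ i, ∑ j, (X i j) ^ 2 :=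
  Real.sq_sqrt (Finset.sum_nonneg fun i _ => Finset.sum_nonneg fun j _ => sq_nonneg _)

lemma aux_rank1 {n : ℕ} (D : Matrix (Fin n) (Fin n) ℝ) (c : Fin n → ℝ) (t : ℝ) :
    frobNorm (D - t • Matrix.vecMulVec (D.mulVec c) c) ^ 2
      = frobNorm D ^ 2 - (2 * t - t ^ 2 * ∑ j, c j ^ 2) * ∑ i, (D.mulVec c i) ^ 2 := by
  rw [aux_frob_sq, aux_frob_sq, Finset.mul_sum, ← Finset.sum_sub_distrib]
  apply Finset.sum_congr rfl
  intro i _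
  have hw : D.mulVec c i = ∑ j, D i j * c j := rfl
  have : ∀ j, (D - t • Matrix.vecMulVec (D.mulVec c) c) i j ^ 2
      = D i j ^ 2 - 2 * t * D.mulVec c i * (D i j * c j) + t^2 * D.mulVec c i ^ 2 * c j ^ 2 := by
    intro j
    simp only [Matrix.sub_apply, Matrix.smul_apply, Matrix.vecMulVec_apply, smul_eq_mul]
    ring
  simp only [this]
  rw [Finset.sum_add_distrib, Finset.sum_sub_distrib, ← Finset.mul_sum, ← Finset.mul_sum, ← hw]
  ring

/-- **Lemma 5, part (32)–(33).** For the quasi-Newton updates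
`B_{k+1} = B_k + θ_k (A_{k+1}s_k − B_k s_k)c_kᵀ/‖c_k‖²` with
`(B_k − A_{k+1})c_k = (B_k − A_{k+1})s_k` and slowly varying `A_k`,
if `∑ ‖s_k‖ < ∞` then `∑ ξ_k² < ∞` for `ξ_k = ‖A_{k+1}s_k − B_k s_k‖/‖c_k‖`;
in particular the whole sequence `ξ_k` tends to zero. -/
theorem stmt_10 {n : ℕ} (hn : 1 ≤ n) (θbar C : ℝ)
    (hθbar : θbar ∈ Set.Ioo (0 : ℝ) 1) (hC : 0 < C)
    (B A : ℕ → Matrix (Fin n) (Fin n) ℝ)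
    (s c : ℕ → EuclideanSpace ℝ (Fin n)) (hs : ∀ k, s k ≠ 0) (hc : ∀ k, c k ≠ 0)
    (θ : ℕ → ℝ) (hθ : ∀ k, |θ k - 1| ≤ θbar)
    (hupd : ∀ k : ℕ, B (k + 1) = B k + (θ k / ‖c k‖ ^ 2) •
      Matrix.vecMulVec ((A (k + 1)).mulVec (s k) - (B k).mulVec (s k)) (c k))
    (hcs : ∀ k : ℕ,
      (B k - A (k + 1)).mulVec (c k) = (B k - A (k + 1)).mulVec (s k))
    (hA : ∀ k : ℕ,
      frobNorm (A (k + 1) - A k) ≤ C * ∑ i ∈ Finset.Icc (k - n) k, ‖s i‖)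
    (ξ : ℕ → ℝ)
    (hξ : ∀ k : ℕ, ξ k =
      ‖Matrix.toEuclideanLin (A (k + 1)) (s k) - Matrix.toEuclideanLin (B k) (s k)‖ / ‖c k‖)
    (hsum : Summable fun k => ‖s k‖) :
    Summable (fun k => (ξ k) ^ 2) ∧ Tendsto ξ atTop (nhds 0) := by
  obtain ⟨h0, h1⟩ := hθbar
  have hδ : 0 < 1 - θbar ^ 2 := by nlinarith
  have hd : Summable fun k => frobNorm (A (k+1) - A k) :=
    Summable.of_nonneg_of_le (fun k => Real.sqrt_nonneg _) hA
      ((aux_window n _ (fun k => norm_nonneg _) hsum).mul_left C)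
  have hξ2 : ∀ k, ξ k ^ 2 = (∑ i, ((B k - A (k+1)).mulVec (c k) i) ^ 2) / ‖c k‖ ^ 2 := by
    intro k
    rw [hξ, div_pow, hcs, ← norm_neg, EuclideanSpace.norm_sq_eq]
    congr 1
    apply Finset.sum_congr rfl
    intro i _
    simp [Matrix.sub_mulVec, Matrix.toLpLin_apply]
  have main : Summable fun k => (1 - θbar ^ 2) * ξ k ^ 2 := by
    refine aux_real (fun k => frobNorm (B k - A k)) (fun k => frobNorm (A (k+1) - A k)) _
      (fun k => Real.sqrt_nonneg _) (fun k => Real.sqrt_nonneg _)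
      (fun k => mul_nonneg hδ.le (sq_nonneg _)) (fun k => ?_) hd
    have hcp : 0 < ‖c k‖ ^ 2 := by have := norm_pos_iff.mpr (hc k); positivity
    have e1 : B (k+1) - A (k+1) = (B k - A (k+1))
        - (θ k / ‖c k‖ ^ 2) • Matrix.vecMulVec ((B k - A (k+1)).mulVec (c k)) (c k) := by
      rw [hcs, hupd, Matrix.sub_mulVec]
      ext i j
      simp only [Matrix.sub_apply, Matrix.add_apply, Matrix.smul_apply, Matrix.vecMulVec_apply,
        smul_eq_mul, Pi.sub_apply]
      ring
    have e2 := aux_rank1 (B k - A (k+1)) (c k) (θ k / ‖c k‖ ^ 2)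
    rw [← e1] at e2
    have e3 : ∑ j, c k j ^ 2 = ‖c k‖ ^ 2 := by
      rw [EuclideanSpace.norm_sq_eq]; simp
    have e4 : frobNorm (B (k+1) - A (k+1)) ^ 2
        = frobNorm (B k - A (k+1)) ^ 2 - (2 * θ k - θ k ^ 2) * ξ k ^ 2 := by
      rw [e2, e3, hξ2]
      field_simp
    have e5 : frobNorm (B k - A (k+1)) ≤ frobNorm (B k - A k) + frobNorm (A (k+1) - A k) := by
      have h := aux_frob_add (B k - A k) (-(A (k+1) - A k))
      have hneg : frobNorm (-(A (k+1) - A k)) = frobNorm (A (k+1) - A k) := by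
        unfold frobNorm; congr 1
        simp only [Matrix.neg_apply, neg_sq]
      rw [hneg] at h
      convert h using 2
      abel
    have e6 : frobNorm (B k - A (k+1)) ^ 2 ≤ (frobNorm (B k - A k) + frobNorm (A (k+1) - A k)) ^ 2 :=
      pow_le_pow_left₀ (Real.sqrt_nonneg _) e5 2
    have e7 : (θ k - 1) ^ 2 ≤ θbar ^ 2 := by
      rw [← sq_abs]; exact pow_le_pow_left₀ (abs_nonneg _) (hθ k) 2
    have e8 : (1 - θbar ^ 2) * ξ k ^ 2 ≤ (2 * θ k - θ k ^ 2) * ξ k ^ 2 :=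
      mul_le_mul_of_nonneg_right (by nlinarith) (sq_nonneg _)
    show frobNorm (B (k+1) - A (k+1)) ^ 2 + _ ≤ _
    linarith
  have hsq : Summable fun k => ξ k ^ 2 := (summable_mul_left_iff hδ.ne').mp main
  refine ⟨hsq, ?_⟩
  have := hsq.tendsto_atTop_zero.sqrt
  simp only [Real.sqrt_sq_eq_abs, Real.sqrt_zero] at this
  exact (tendsto_zero_iff_abs_tendsto_zero ξ).mpr this
end

section
/- Let F : ℝⁿ → ℝⁿ be continuous, let x ∈ ℝⁿ with F(x) ≠ 0, let p ∈ ℝⁿ, and let σ₁ > 0 and η > 0. Then there exists λ̄ > 0 such that for every λ ∈ (0, λ̄], ‖F(x + λ p)‖ ≤ ‖F(x)‖ − σ₁ ‖λ p‖² + η ‖F(x)‖. In particular, the backtracking procedure that tries λ = 1, β, β², … for any fixed β ∈ (0,1) terminates after finitely many steps with a step length satisfying this condition. -/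
/-- **Feasibility of the Li–Fukushima line search.** If `F` is continuous and
`F x ≠ 0`, then all sufficiently small step lengths `λ > 0` satisfy the nonmonotone
line-search condition `‖F(x + λp)‖ ≤ ‖F x‖ − σ₁‖λp‖² + η‖F x‖`; in particular the
backtracking procedure `λ = 1, β, β², …` terminates after finitely many steps. -/
theorem stmt_11 {n : ℕ} (F : EuclideanSpace ℝ (Fin n) → EuclideanSpace ℝ (Fin n))
    (hF : Continuous F) (x p : EuclideanSpace ℝ (Fin n)) (hx : F x ≠ 0)
    (σ₁ η : ℝ) (hσ₁ : 0 < σ₁) (hη : 0 < η) :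
    (∃ lam_bar > (0 : ℝ), ∀ lam : ℝ, 0 < lam → lam ≤ lam_bar →
      ‖F (x + lam • p)‖ ≤ ‖F x‖ - σ₁ * ‖lam • p‖ ^ 2 + η * ‖F x‖) ∧
    ∀ β ∈ Set.Ioo (0 : ℝ) 1, ∃ m : ℕ,
      ‖F (x + β ^ m • p)‖ ≤ ‖F x‖ - σ₁ * ‖β ^ m • p‖ ^ 2 + η * ‖F x‖ := by
  have key : ∃ lam_bar > (0 : ℝ), ∀ lam : ℝ, 0 < lam → lam ≤ lam_bar →
      ‖F (x + lam • p)‖ ≤ ‖F x‖ - σ₁ * ‖lam • p‖ ^ 2 + η * ‖F x‖ := by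
    have hc : Continuous (fun t : ℝ => ‖F (x + t • p)‖ + σ₁ * ‖t • p‖ ^ 2) := by fun_prop
    have hpos : 0 < η * ‖F x‖ := mul_pos hη (norm_pos_iff.mpr hx)
    have h0 : (fun t : ℝ => ‖F (x + t • p)‖ + σ₁ * ‖t • p‖ ^ 2) 0 < ‖F x‖ + η * ‖F x‖ := by
      simpa using hpos
    have hev := hc.continuousAt.eventually (gt_mem_nhds h0)
    obtain ⟨ε, hε, h⟩ := Metric.eventually_nhds_iff.mp hev
    refine ⟨ε / 2, by positivity, fun t ht hte => ?_⟩
    have h1 : dist t 0 < ε := by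
      rw [Real.dist_eq, sub_zero, abs_of_pos ht]
      linarith
    have h2 := h h1
    linarith
  refine ⟨key, fun β hβ => ?_⟩
  obtain ⟨b, hb, h⟩ := key
  obtain ⟨m, hm⟩ := exists_pow_lt_of_lt_one hb hβ.2
  exact ⟨m, h _ (pow_pos hβ.1 m) hm.le⟩
end
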